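/- arXiv:2310.18737 — 11 statements merged into one kernel-verified Lean document; each statement's English description precedes it below -/
import Mathlib

section
/- If (h,s) is balanced, then P * Pᵀ = (K / K') • (identity matrix of size K'), where K / K' is interpreted as the real number K/K'. -/
open Matrix BigOperators

/-- for balanced `(h,s)`, `P * Pᵀ = (K / K') • I`. -/
theorem countSketch_PPt_balanced (K K' : ℕ) (hK : 0 < K) (hK' : 0 < K')
    (h : Fin K → Fin K') (s : Fin K → ℝ) (hs : ∀ j, s j = -1 ∨ s j = 1)
    (P : Matrix (Fin K') (Fin K) ℝ)
    (hP : ∀ i j, P i j = if h j = i then s j else 0)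
    (hdvd : K' ∣ K)
    (hbal : ∀ i : Fin K', (Finset.univ.filter fun j : Fin K => h j = i).card = K / K') :
    P * Pᵀ = ((K : ℝ) / (K' : ℝ)) • (1 : Matrix (Fin K') (Fin K') ℝ) := by
  have hne : (K' : ℝ) ≠ 0 := by exact_mod_cast hK'.ne'
  ext i k
  rw [Matrix.mul_apply, Matrix.smul_apply, smul_eq_mul]
  by_cases hik : i = k
  · subst hik
    rw [Matrix.one_apply_eq, mul_one, ← Nat.cast_div hdvd hne, ← hbal i, Finset.card_filter,
      Nat.cast_sum]
    refine Finset.sum_congr rfl fun j _ => ?_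
    rw [Matrix.transpose_apply, hP]
    by_cases hj : h j = i
    · rcases hs j with e | e <;> simp [hj, e]
    · simp [hj]
  · rw [Matrix.one_apply_ne hik, mul_zero]
    refine Finset.sum_eq_zero fun j _ => ?_
    rw [Matrix.transpose_apply, hP, hP]
    by_cases hj : h j = i
    · have hk : h j ≠ k := fun e => hik (hj.symm.trans e)
      rw [if_neg hk, mul_zero]
    · rw [if_neg hj, zero_mul]
end

section
/- If (h,s) is balanced, then the matrix Q := (K'/K) • (Pᵀ * P) is symmetric and idempotent: Qᵀ = Q and Q * Q = Q. -/
open Matrix BigOperators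

/-- for balanced `(h,s)`, `Q = (K'/K) • (Pᵀ * P)` is a symmetric
idempotent (an orthogonal projection matrix). -/
theorem countSketch_Q_projection (K K' : ℕ) (hK : 0 < K) (hK' : 0 < K')
    (h : Fin K → Fin K') (s : Fin K → ℝ) (hs : ∀ j, s j = -1 ∨ s j = 1)
    (P : Matrix (Fin K') (Fin K) ℝ)
    (hP : ∀ i j, P i j = if h j = i then s j else 0)
    (hdvd : K' ∣ K)
    (hbal : ∀ i : Fin K', (Finset.univ.filter fun j : Fin K => h j = i).card = K / K')
    (Q : Matrix (Fin K) (Fin K) ℝ)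
    (hQ : Q = ((K' : ℝ) / (K : ℝ)) • (Pᵀ * P)) :
    Qᵀ = Q ∧ Q * Q = Q := by
  have hPP : P * Pᵀ = ((K : ℝ) / (K' : ℝ)) • (1 : Matrix (Fin K') (Fin K') ℝ) := by
    ext a b
    rw [Matrix.mul_apply, Matrix.smul_apply, Matrix.one_apply]
    simp only [Matrix.transpose_apply, hP]
    by_cases hab : a = b
    · subst hab
      have h1 : ∀ j, (if h j = a then s j else 0) * (if h j = a then s j else 0)
          = if h j = a then (1 : ℝ) else 0 := by
        intro j
        split_ifs
        · rcases hs j with e | e <;> rw [e] <;> norm_num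
        · norm_num
      rw [Finset.sum_congr rfl (fun j _ => h1 j), Finset.sum_boole, hbal a,
        Nat.cast_div hdvd (by positivity)]
      simp
    · rw [if_neg hab, smul_zero]
      apply Finset.sum_eq_zero
      intro j _
      by_cases h1 : h j = a
      · rw [if_neg (fun h2 : h j = b => hab (h1.symm.trans h2)), mul_zero]
      · rw [if_neg h1, zero_mul]
  have hK1 : (K : ℝ) ≠ 0 := by positivity
  have hK2 : (K' : ℝ) ≠ 0 := by positivity
  subst hQ
  constructor
  · rw [Matrix.transpose_smul, Matrix.transpose_mul, Matrix.transpose_transpose]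
  · have e : Pᵀ * P * (Pᵀ * P) = ((K : ℝ) / (K' : ℝ)) • (Pᵀ * P) := by
      rw [Matrix.mul_assoc, ← Matrix.mul_assoc P, hPP, Matrix.smul_mul, Matrix.one_mul,
        Matrix.mul_smul]
    rw [Matrix.smul_mul, Matrix.mul_smul, e, smul_smul, smul_smul]
    congr 1
    field_simp
end

section
/- If (h,s) is balanced, then the matrix P† := (K'/K) • Pᵀ satisfies the four Moore–Penrose conditions: P * P† * P = P, P† * P * P† = P†, (P * P†)ᵀ = P * P†, and (P† * P)ᵀ = P† * P; moreover P * P† equals the identity matrix of size K'. Hence (K'/K) • Pᵀ is the Moore–Penrose pseudoinverse of P. -/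
open Matrix BigOperators

/-- for balanced `(h,s)`, `P† = (K'/K) • Pᵀ` satisfies the four
Moore–Penrose conditions and `P * P† = 1`, hence it is the Moore–Penrose
pseudoinverse of `P`. -/
theorem countSketch_pseudoinverse (K K' : ℕ) (hK : 0 < K) (hK' : 0 < K')
    (h : Fin K → Fin K') (s : Fin K → ℝ) (hs : ∀ j, s j = -1 ∨ s j = 1)
    (P : Matrix (Fin K') (Fin K) ℝ)
    (hP : ∀ i j, P i j = if h j = i then s j else 0)
    (hdvd : K' ∣ K)
    (hbal : ∀ i : Fin K', (Finset.univ.filter fun j : Fin K => h j = i).card = K / K')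
    (Pdag : Matrix (Fin K) (Fin K') ℝ)
    (hPdag : Pdag = ((K' : ℝ) / (K : ℝ)) • Pᵀ) :
    P * Pdag * P = P ∧
    Pdag * P * Pdag = Pdag ∧
    (P * Pdag)ᵀ = P * Pdag ∧
    (Pdag * P)ᵀ = Pdag * P ∧
    P * Pdag = (1 : Matrix (Fin K') (Fin K') ℝ) := by
  have hKr : (K : ℝ) ≠ 0 := by exact_mod_cast hK.ne'
  have hKr' : (K' : ℝ) ≠ 0 := by exact_mod_cast hK'.ne'
  have key : P * Pdag = (1 : Matrix (Fin K') (Fin K') ℝ) := by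
    subst hPdag
    rw [Matrix.mul_smul]
    ext a b
    rw [Matrix.smul_apply, Matrix.mul_apply, Matrix.one_apply]
    simp only [Matrix.transpose_apply, hP, smul_eq_mul]
    by_cases hab : a = b
    · subst hab
      have h1 : ∀ j, ((if h j = a then s j else 0) * (if h j = a then s j else 0) : ℝ)
          = if h j = a then 1 else 0 := by
        intro j
        rcases hs j with e | e <;> split_ifs <;> simp [e]
      rw [Finset.sum_congr rfl (fun j _ => h1 j), Finset.sum_boole, hbal a,
        Nat.cast_div hdvd hKr', if_pos rfl]
      field_simp
    · rw [if_neg hab, Finset.sum_eq_zero, mul_zero]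
      intro j _
      by_cases hj : h j = a
      · have : h j ≠ b := fun e => hab (hj.symm.trans e)
        simp [this]
      · simp [hj]
  refine ⟨?_, ?_, ?_, ?_, key⟩
  · rw [key, Matrix.one_mul]
  · rw [Matrix.mul_assoc, key, Matrix.mul_one]
  · rw [key, Matrix.transpose_one]
  · rw [hPdag, Matrix.smul_mul, Matrix.transpose_smul, Matrix.transpose_mul,
      Matrix.transpose_transpose]
end

section
/- If (h,s) is balanced and Q := (K'/K) • (Pᵀ * P), then for every vector φ ∈ ℝ^{K}: (i) the vector Q.mulVec φ lies in the subspace S ⊆ ℝ^{K} spanned by the rows of P (the span of the vectors j ↦ P i j over i : Fin K'); (ii) the residual φ − Q.mulVec φ is orthogonal to every element of S with respect to the Euclidean inner product; and consequently (iii) ‖φ − Q.mulVec φ‖ equals the distance from φ to S, i.e., the infimum of ‖φ − v‖ over v ∈ S. -/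
open Matrix BigOperators RealInnerProductSpace

/-- for balanced `(h,s)` and `Q = (K'/K) • (Pᵀ * P)`, the vector
`Q.mulVec φ` lies in the span `S` of the rows of `P`, the residual
`φ - Q.mulVec φ` is orthogonal to `S`, and `‖φ - Q.mulVec φ‖` is the distance
from `φ` to `S`. -/
theorem countSketch_projection_ontoRowSpace (K K' : ℕ) (hK : 0 < K) (hK' : 0 < K')
    (h : Fin K → Fin K') (s : Fin K → ℝ) (hs : ∀ j, s j = -1 ∨ s j = 1)
    (P : Matrix (Fin K') (Fin K) ℝ)
    (hP : ∀ i j, P i j = if h j = i then s j else 0)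
    (hdvd : K' ∣ K)
    (hbal : ∀ i : Fin K', (Finset.univ.filter fun j : Fin K => h j = i).card = K / K')
    (Q : Matrix (Fin K) (Fin K) ℝ)
    (hQ : Q = ((K' : ℝ) / (K : ℝ)) • (Pᵀ * P))
    (S : Submodule ℝ (EuclideanSpace ℝ (Fin K)))
    (hS : S = Submodule.span ℝ (Set.range fun i : Fin K' =>
      ((WithLp.equiv 2 (Fin K → ℝ)).symm fun j : Fin K => P i j))) :
    ∀ φ : EuclideanSpace ℝ (Fin K),
      ((WithLp.equiv 2 (Fin K → ℝ)).symm (Q.mulVec (WithLp.equiv 2 (Fin K → ℝ) φ)) ∈ S) ∧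
      (∀ v ∈ S,
        ⟪φ - (WithLp.equiv 2 (Fin K → ℝ)).symm (Q.mulVec (WithLp.equiv 2 (Fin K → ℝ) φ)), v⟫ = 0) ∧
      ‖φ - (WithLp.equiv 2 (Fin K → ℝ)).symm (Q.mulVec (WithLp.equiv 2 (Fin K → ℝ) φ))‖ =
        Metric.infDist φ (S : Set (EuclideanSpace ℝ (Fin K))) := by
  intro φ
  have hKr : (K : ℝ) ≠ 0 := by exact_mod_cast hK.ne'
  have hKr' : (K' : ℝ) ≠ 0 := by exact_mod_cast hK'.ne'
  have hPP : P * Pᵀ = ((K : ℝ) / (K' : ℝ)) • (1 : Matrix (Fin K') (Fin K') ℝ) := by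
    ext i k
    rw [Matrix.mul_apply, Matrix.smul_apply, Matrix.one_apply]
    simp only [Matrix.transpose_apply, hP]
    by_cases hik : i = k
    · subst hik
      have h1 : ∀ j, ((if h j = i then s j else 0) * (if h j = i then s j else 0) : ℝ)
          = if h j = i then 1 else 0 := by
        intro j
        split_ifs
        · rcases hs j with e | e <;> rw [e] <;> norm_num
        · simp
      rw [Finset.sum_congr rfl (fun j _ => h1 j), Finset.sum_boole, hbal i,
        Nat.cast_div hdvd hKr']
      simp
    · rw [if_neg hik, smul_zero]
      apply Finset.sum_eq_zero
      intro j _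
      by_cases h1 : h j = i
      · have h2 : h j ≠ k := fun e => hik (h1.symm.trans e)
        rw [if_neg h2, mul_zero]
      · rw [if_neg h1, zero_mul]
  set f : Fin K → ℝ := WithLp.equiv 2 (Fin K → ℝ) φ with hf
  have hPQ : P *ᵥ (f - Q *ᵥ f) = 0 := by
    have : P * Q = P := by
      rw [hQ, Matrix.mul_smul, ← Matrix.mul_assoc, hPP, Matrix.smul_mul, Matrix.one_mul,
        smul_smul]
      rw [show (K' : ℝ) / K * (K / K') = 1 by field_simp, one_smul]
    rw [Matrix.mulVec_sub, Matrix.mulVec_mulVec, this, sub_self]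
  have hmem : (WithLp.equiv 2 (Fin K → ℝ)).symm (Q *ᵥ f) ∈ S := by
    have : (WithLp.equiv 2 (Fin K → ℝ)).symm (Q *ᵥ f) =
        ∑ i : Fin K', (((K' : ℝ) / K) * (P *ᵥ f) i) •
          ((WithLp.equiv 2 (Fin K → ℝ)).symm fun j : Fin K => P i j) := by
      ext j
      rw [hQ, Matrix.smul_mulVec, ← Matrix.mulVec_mulVec]
      simp only [WithLp.equiv_symm_apply, WithLp.ofLp_sum, WithLp.ofLp_smul, Finset.sum_apply,
        Pi.smul_apply, smul_eq_mul]
      rw [Matrix.mulVec, dotProduct, Finset.mul_sum]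
      apply Finset.sum_congr rfl
      intro i _
      rw [Matrix.transpose_apply]
      ring
    rw [this, hS]
    exact Submodule.sum_mem _ fun i _ =>
      Submodule.smul_mem _ _ (Submodule.subset_span ⟨i, rfl⟩)
  have horth : ∀ v ∈ S, ⟪φ - (WithLp.equiv 2 (Fin K → ℝ)).symm (Q *ᵥ f), v⟫ = 0 := by
    intro v hv
    rw [hS] at hv
    induction hv using Submodule.span_induction with
    | mem x hx =>
      obtain ⟨i, rfl⟩ := hx
      have := congrFun hPQ i
      rw [Matrix.mulVec, dotProduct] at this
      rw [PiLp.inner_apply]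
      simpa [hf] using this
    | zero => simp
    | add x y _ _ hx hy => rw [inner_add_right, hx, hy, add_zero]
    | smul a x _ hx => rw [inner_smul_right, hx, mul_zero]
  refine ⟨hmem, horth, le_antisymm ?_ ?_⟩
  · rw [Metric.le_infDist ⟨_, hmem⟩]
    intro v hv
    rw [dist_eq_norm]
    have h0 := horth _ (S.sub_mem hmem hv)
    have h1 := norm_add_sq_eq_norm_sq_add_norm_sq_of_inner_eq_zero _ _ h0
    rw [sub_add_sub_cancel] at h1
    refine abs_le_of_sq_le_sq' ?_ (norm_nonneg _) |>.2
    nlinarith [mul_self_nonneg ‖(WithLp.equiv 2 (Fin K → ℝ)).symm (Q *ᵥ f) - v‖]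
  · rw [← dist_eq_norm]
    exact Metric.infDist_le_dist_of_mem hmem
end

section
/- If an index j : Fin K has no hash collisions, i.e., h k ≠ h j for every k ≠ j, then the j-th coordinate of any vector is exactly recovered after sketching and retraction: for every x ∈ ℝ^{K}, ((Pᵀ * P).mulVec x) j = x j. -/
open Matrix BigOperators

/-- a coordinate without hash collisions is exactly recovered by
sketching followed by retraction. -/
theorem countSketch_noCollision_exactRecovery (K K' : ℕ) (hK : 0 < K) (hK' : 0 < K')
    (h : Fin K → Fin K') (s : Fin K → ℝ) (hs : ∀ j, s j = -1 ∨ s j = 1)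
    (P : Matrix (Fin K') (Fin K) ℝ)
    (hP : ∀ i j, P i j = if h j = i then s j else 0)
    (j : Fin K) (hnocol : ∀ k : Fin K, k ≠ j → h k ≠ h j) :
    ∀ x : Fin K → ℝ, ((Pᵀ * P).mulVec x) j = x j := by
  intro x
  have hss : s j * s j = 1 := by
    rcases hs j with e | e <;> rw [e] <;> norm_num
  have key : ∀ k, (Pᵀ * P) j k = if k = j then 1 else 0 := by
    intro k
    rw [Matrix.mul_apply]
    simp only [Matrix.transpose_apply, hP, ite_mul, zero_mul, Finset.sum_ite_eq,
      Finset.mem_univ, if_true]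
    by_cases hk : k = j
    · subst hk
      simp [hss]
    · simp [hk, hnocol k hk]
  simp [Matrix.mulVec, dotProduct, key]
end

section
/- Under the uniform distribution on pairs (h,s), the expected Gram matrix of the count sketch matrix is the identity: for all j, k in Fin K, the average of (P(h,s)ᵀ * P(h,s)) j k over all (h,s) equals 1 if j = k and 0 otherwise. -/
open Matrix BigOperators Finset

/-- The count sketch matrix `P(h,s)`. -/
def sketchP (K K' : ℕ) (h : Fin K → Fin K') (s : Fin K → ℝ) :
    Matrix (Fin K') (Fin K) ℝ :=
  Matrix.of fun i j => if h j = i then s j else 0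

/-- Expectation (average) over the uniform distribution on pairs `(h, s)` with
`h : Fin K → Fin K'` and `s : Fin K → {-1, 1}`. -/
noncomputable def sketchE (K K' : ℕ)
    (f : (Fin K → Fin K') → (Fin K → ℝ) → ℝ) : ℝ :=
  (∑ ω : (Fin K → Fin K') × (Fin K → ({-1, 1} : Finset ℝ)),
      f ω.1 (fun j => (ω.2 j : ℝ))) /
    (Fintype.card ((Fin K → Fin K') × (Fin K → ({-1, 1} : Finset ℝ))) : ℝ)

/-- Variance over the uniform distribution on pairs `(h, s)`. -/
noncomputable def sketchVar (K K' : ℕ)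
    (f : (Fin K → Fin K') → (Fin K → ℝ) → ℝ) : ℝ :=
  sketchE K K' (fun h s => (f h s) ^ 2) - (sketchE K K' f) ^ 2

/-- Sign flip on `{-1, 1}`. -/
def signFlip (x : ({-1, 1} : Finset ℝ)) : ({-1, 1} : Finset ℝ) :=
  ⟨-(x : ℝ), by
    have hx := x.2
    simp only [Finset.mem_insert, Finset.mem_singleton] at hx ⊢
    rcases hx with hx | hx <;> rw [hx] <;> norm_num⟩

lemma signFlip_signFlip (x : ({-1, 1} : Finset ℝ)) : signFlip (signFlip x) = x := by
  apply Subtype.ext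
  simp [signFlip]

lemma pmOne_mul_self (x : ({-1, 1} : Finset ℝ)) : (x : ℝ) * x = 1 := by
  have hx := x.2
  simp only [Finset.mem_insert, Finset.mem_singleton] at hx
  rcases hx with hx | hx <;> rw [hx] <;> norm_num

lemma gram_apply (K K' : ℕ) (h : Fin K → Fin K') (s : Fin K → ℝ) (j k : Fin K) :
    ((sketchP K K' h s)ᵀ * sketchP K K' h s) j k = if h j = h k then s j * s k else 0 := by
  simp [sketchP, Matrix.mul_apply]

/-- Flip the sign at coordinate `j`. -/
def flipAt (K K' : ℕ) (j : Fin K)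
    (ω : (Fin K → Fin K') × (Fin K → ({-1, 1} : Finset ℝ))) :
    (Fin K → Fin K') × (Fin K → ({-1, 1} : Finset ℝ)) :=
  (ω.1, Function.update ω.2 j (signFlip (ω.2 j)))

lemma flipAt_involutive (K K' : ℕ) (j : Fin K) : Function.Involutive (flipAt K K' j) := by
  intro ω
  simp [flipAt, signFlip_signFlip]

/-- the expected Gram matrix of the count sketch matrix is the
identity. -/
theorem countSketch_expected_gram_identity (K K' : ℕ) (hK : 0 < K) (hK' : 0 < K')
    (j k : Fin K) :
    sketchE K K' (fun h s => ((sketchP K K' h s)ᵀ * sketchP K K' h s) j k) =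
      if j = k then 1 else 0 := by
  unfold sketchE
  simp only [gram_apply]
  by_cases hjk : j = k
  · subst hjk
    have : Nonempty (Fin K') := ⟨⟨0, hK'⟩⟩
    have : Nonempty ({-1, 1} : Finset ℝ) := ⟨⟨1, by simp⟩⟩
    have hc : (Fintype.card ((Fin K → Fin K') × (Fin K → ({-1, 1} : Finset ℝ))) : ℝ) ≠ 0 :=
      Nat.cast_ne_zero.mpr Fintype.card_ne_zero
    simp only [if_true, pmOne_mul_self, Finset.sum_const, Finset.card_univ, nsmul_eq_mul, mul_one]
    exact div_self hc
  · rw [if_neg hjk]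
    have key := Equiv.sum_comp (Function.Involutive.toPerm _ (flipAt_involutive K K' j))
      (fun ω : (Fin K → Fin K') × (Fin K → ({-1, 1} : Finset ℝ)) =>
        if ω.1 j = ω.1 k then (ω.2 j : ℝ) * (ω.2 k : ℝ) else 0)
    have hneg : ∀ ω : (Fin K → Fin K') × (Fin K → ({-1, 1} : Finset ℝ)),
        (fun ω : (Fin K → Fin K') × (Fin K → ({-1, 1} : Finset ℝ)) =>
          if ω.1 j = ω.1 k then (ω.2 j : ℝ) * (ω.2 k : ℝ) else 0)
          ((Function.Involutive.toPerm _ (flipAt_involutive K K' j)) ω) =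
        -(if ω.1 j = ω.1 k then (ω.2 j : ℝ) * (ω.2 k : ℝ) else 0) := by
      intro ω
      have hkj : k ≠ j := fun e => hjk e.symm
      simp only [Function.Involutive.coe_toPerm, flipAt, Function.update_self,
        Function.update_of_ne hkj, signFlip]
      split_ifs <;> ring
    rw [Finset.sum_congr rfl (fun ω _ => hneg ω), Finset.sum_neg_distrib] at key
    rw [div_eq_zero_iff]
    left
    linarith
end

section
/- The count sketch preserves squared norms in expectation: for every vector x ∈ ℝ^{K}, E_{h,s}[‖P(h,s).mulVec x‖²] = ‖x‖², where ‖·‖ is the Euclidean norm. -/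
open Matrix BigOperators Finset

/-- The sign flip on `{-1, 1}`. -/
def sgnFlip (a : ({-1, 1} : Finset ℝ)) : ({-1, 1} : Finset ℝ) :=
  ⟨-(a : ℝ), by
    have h := a.2
    simp only [Finset.mem_insert, Finset.mem_singleton] at h ⊢
    rcases h with h | h <;> rw [h] <;> norm_num⟩

lemma sgn_sq (a : ({-1, 1} : Finset ℝ)) : (a : ℝ) * a = 1 := by
  have h := a.2
  simp only [Finset.mem_insert, Finset.mem_singleton] at h
  rcases h with h | h <;> rw [h] <;> norm_num

lemma sum_sgn_mul (K : ℕ) (j k : Fin K) :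
    ∑ s : Fin K → ({-1, 1} : Finset ℝ), (s j : ℝ) * s k =
      if j = k then (Fintype.card (Fin K → ({-1, 1} : Finset ℝ)) : ℝ) else 0 := by
  split_ifs with hjk
  · subst hjk
    simp only [sgn_sq, Finset.sum_const, Finset.card_univ, nsmul_eq_mul, mul_one]
  · have hinv : Function.Involutive
        (fun s : Fin K → ({-1, 1} : Finset ℝ) => Function.update s j (sgnFlip (s j))) := by
      intro s
      ext l
      by_cases hl : l = j
      · subst hl
        simp [sgnFlip]
      · simp [hl]
    have h := Equiv.sum_comp hinv.toPerm
      (fun s : Fin K → ({-1, 1} : Finset ℝ) => (s j : ℝ) * s k)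
    have hkj : k ≠ j := fun e => hjk e.symm
    simp only [Function.Involutive.coe_toPerm, Function.update_self,
      Function.update_of_ne hkj, sgnFlip, neg_mul, Finset.sum_neg_distrib] at h
    linarith

lemma sketch_pointwise (K K' : ℕ) (h : Fin K → Fin K') (s x : Fin K → ℝ) :
    ∑ i : Fin K', ((sketchP K K' h s).mulVec x) i ^ 2 =
      ∑ j, ∑ k, (if h k = h j then x j * x k else 0) * (s j * s k) := by
  simp only [Matrix.mulVec, dotProduct, sketchP, Matrix.of_apply, sq, Finset.sum_mul_sum]
  rw [Finset.sum_comm]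
  refine Finset.sum_congr rfl fun j _ => ?_
  rw [Finset.sum_comm]
  refine Finset.sum_congr rfl fun k _ => ?_
  rw [Finset.sum_eq_single (h j)]
  · by_cases e : h k = h j
    · simp [e]; ring
    · simp [e]
  · intro i _ hi
    simp [hi.symm]
  · simp

/-- the count sketch preserves squared Euclidean norms in
expectation: `E[‖Px‖²] = ‖x‖²`. -/
theorem countSketch_norm_unbiased (K K' : ℕ) (hK : 0 < K) (hK' : 0 < K')
    (x : Fin K → ℝ) :
    sketchE K K' (fun h s =>
        ∑ i : Fin K', ((sketchP K K' h s).mulVec x) i ^ 2) =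
      ∑ j : Fin K, x j ^ 2 := by
  have : Nonempty (Fin K') := ⟨⟨0, hK'⟩⟩
  have : Nonempty ({-1, 1} : Finset ℝ) := ⟨⟨1, by simp⟩⟩
  unfold sketchE
  rw [div_eq_iff (Nat.cast_ne_zero.mpr Fintype.card_ne_zero), Fintype.sum_prod_type]
  have key : ∀ h : Fin K → Fin K',
      ∑ s : Fin K → ({-1, 1} : Finset ℝ),
        ∑ i : Fin K', ((sketchP K K' h (fun j => (s j : ℝ))).mulVec x) i ^ 2 =
      (∑ j, x j ^ 2) * (Fintype.card (Fin K → ({-1, 1} : Finset ℝ)) : ℝ) := by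
    intro h
    simp only [sketch_pointwise]
    rw [Finset.sum_comm, Finset.sum_mul]
    refine Finset.sum_congr rfl fun j _ => ?_
    rw [Finset.sum_comm]
    simp only [← Finset.mul_sum, sum_sgn_mul]
    simp [sq]
  simp only [key, Finset.sum_const, Finset.card_univ, nsmul_eq_mul]
  rw [Fintype.card_prod]
  push_cast
  ring
end

section
/- Exact second moment of the count sketch inner product: for all vectors x, y ∈ ℝ^{K}, E_{h,s}[⟨P(h,s).mulVec x, P(h,s).mulVec y⟩²] = ⟨x,y⟩² + (1/K') ∑_{j ≠ k} (x_j² y_k² + x_j y_j x_k y_k), where the sum is over ordered pairs of distinct indices j, k in Fin K. -/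
open Matrix BigOperators Finset

abbrev CSSign : Type := ({-1, 1} : Finset ℝ)

lemma csSign_sq (t : CSSign) : (t : ℝ) * (t : ℝ) = 1 := by
  obtain ⟨t, ht⟩ := t
  simp only [Finset.mem_insert, Finset.mem_singleton] at ht
  rcases ht with rfl | rfl <;> norm_num

def csNeg (t : CSSign) : CSSign :=
  ⟨-(t : ℝ), by
    obtain ⟨t, ht⟩ := t
    simp only [Finset.mem_insert, Finset.mem_singleton] at ht ⊢
    rcases ht with rfl | rfl <;> norm_num⟩

def csNegEquiv : CSSign ≃ CSSign :=
  Function.Involutive.toPerm csNeg (fun t => by ext; simp [csNeg])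

def csFlip {K : ℕ} (a : Fin K) : (Fin K → CSSign) ≃ (Fin K → CSSign) :=
  Equiv.piCongrRight fun i => if i = a then csNegEquiv else Equiv.refl _

lemma csFlip_apply {K : ℕ} (a i : Fin K) (s : Fin K → CSSign) :
    ((csFlip a s i : CSSign) : ℝ) = if i = a then -(s i : ℝ) else (s i : ℝ) := by
  unfold csFlip
  by_cases h : i = a
  · simp only [h, Equiv.piCongrRight_apply, Pi.map_apply, if_true]
    rfl
  · simp [h]

lemma cs_sum_zero {K : ℕ} (a : Fin K) (f : (Fin K → CSSign) → ℝ)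
    (hf : ∀ s, f (csFlip a s) = - f s) : ∑ s, f s = 0 := by
  have h1 : ∑ s, f (csFlip a s) = ∑ s, f s := Equiv.sum_comp (csFlip a) f
  simp only [hf, Finset.sum_neg_distrib] at h1
  linarith

lemma cs_card (K : ℕ) : (Fintype.card (Fin K → CSSign) : ℝ) = 2 ^ K := by
  have : Fintype.card CSSign = 2 := by
    rw [Fintype.card_coe]
    exact Finset.card_pair (by norm_num)
  simp [this]

lemma cs_two {K : ℕ} {j k : Fin K} (h : j ≠ k) :
    ∑ s : Fin K → CSSign, (s j : ℝ) * (s k : ℝ) = 0 := by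
  apply cs_sum_zero j
  intro s
  simp [csFlip_apply, h.symm]

lemma cs_four {K : ℕ} {j k l m : Fin K} (h : j ≠ k) (h' : l ≠ m) :
    ∑ s : Fin K → CSSign, ((s j : ℝ) * (s k : ℝ)) * ((s l : ℝ) * (s m : ℝ)) =
      2 ^ K * ((if l = j ∧ m = k then 1 else 0) + (if l = k ∧ m = j then 1 else 0)) := by
  have one : ∀ s : Fin K → CSSign, ((s j : ℝ) * (s k : ℝ)) * ((s j : ℝ) * (s k : ℝ)) = 1 := by
    intro s
    linear_combination (s k : ℝ) * (s k : ℝ) * csSign_sq (s j) + csSign_sq (s k)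
  by_cases h1 : l = j ∧ m = k
  · obtain ⟨rfl, rfl⟩ := h1
    rw [Finset.sum_congr rfl (fun s _ => one s)]
    simp [h, ← cs_card]
  by_cases h2 : l = k ∧ m = j
  · obtain ⟨rfl, rfl⟩ := h2
    have one' : ∀ s : Fin K → CSSign,
        ((s m : ℝ) * (s l : ℝ)) * ((s l : ℝ) * (s m : ℝ)) = 1 := by
      intro s
      linear_combination (s l : ℝ) * (s l : ℝ) * csSign_sq (s m) + csSign_sq (s l)
    rw [Finset.sum_congr rfl (fun s _ => one' s)]
    simp [h, ← cs_card, h']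
  rw [if_neg h1, if_neg h2, add_zero, mul_zero]
  by_cases hj : j = l ∨ j = m
  · apply cs_sum_zero k
    intro s
    have e1 : l ≠ k := by rintro rfl; grind
    have e2 : m ≠ k := by rintro rfl; grind
    simp [csFlip_apply, h, e1, e2]
  · push Not at hj
    apply cs_sum_zero j
    intro s
    simp [csFlip_apply, h.symm, hj.1.symm, hj.2.symm]

lemma cs_quad {K : ℕ} (D : ℝ) (A : Fin K → Fin K → ℝ) (hA : ∀ j, A j j = 0) :
    ∑ s : Fin K → CSSign, (D + ∑ j, ∑ k, A j k * ((s j : ℝ) * (s k : ℝ))) ^ 2 =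
      2 ^ K * (D ^ 2 + ∑ j, ∑ k, (A j k ^ 2 + A j k * A k j)) := by
  have lin : ∑ s : Fin K → CSSign, ∑ j, ∑ k, A j k * ((s j : ℝ) * (s k : ℝ)) = 0 := by
    rw [Finset.sum_comm]
    refine Finset.sum_eq_zero fun j _ => ?_
    rw [Finset.sum_comm]
    refine Finset.sum_eq_zero fun k _ => ?_
    rw [← Finset.mul_sum]
    by_cases h : j = k
    · subst h; simp [hA]
    · rw [cs_two h, mul_zero]
  have quad : ∑ s : Fin K → CSSign, (∑ j, ∑ k, A j k * ((s j : ℝ) * (s k : ℝ))) ^ 2 =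
      2 ^ K * ∑ j, ∑ k, (A j k ^ 2 + A j k * A k j) := by
    have e : ∀ s : Fin K → CSSign, (∑ j, ∑ k, A j k * ((s j : ℝ) * (s k : ℝ))) ^ 2 =
        ∑ j, ∑ k, ∑ l, ∑ m, (A j k * A l m) *
          (((s j : ℝ) * (s k : ℝ)) * ((s l : ℝ) * (s m : ℝ))) := by
      intro s
      rw [sq, Finset.sum_mul]
      refine Finset.sum_congr rfl fun j _ => ?_
      rw [Finset.sum_mul]
      refine Finset.sum_congr rfl fun k _ => ?_
      rw [Finset.mul_sum]
      refine Finset.sum_congr rfl fun l _ => ?_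
      rw [Finset.mul_sum]
      refine Finset.sum_congr rfl fun m _ => ?_
      ring
    simp only [e]
    rw [Finset.sum_comm, Finset.mul_sum]
    refine Finset.sum_congr rfl fun j _ => ?_
    rw [Finset.sum_comm, Finset.mul_sum]
    refine Finset.sum_congr rfl fun k _ => ?_
    have e2 : ∀ l m, ∑ s : Fin K → CSSign, (A j k * A l m) *
          (((s j : ℝ) * (s k : ℝ)) * ((s l : ℝ) * (s m : ℝ))) =
        (if l = j then (if m = k then 2 ^ K * (A j k * A l m) else 0) else 0) +
        (if l = k then (if m = j then 2 ^ K * (A j k * A l m) else 0) else 0) := by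
      intro l m
      by_cases h : j = k
      · subst h; simp [hA]
      by_cases h' : l = m
      · subst h'; simp [hA]
      rw [← Finset.mul_sum, cs_four h h']
      split_ifs <;> first | (exfalso; grind) | ring
    rw [Finset.sum_comm]
    rw [Finset.sum_congr rfl (fun l _ => Finset.sum_comm)]
    simp only [e2, Finset.sum_add_distrib]
    simp
    ring
  simp only [add_sq, Finset.sum_add_distrib, quad, ← Finset.mul_sum, lin]
  rw [Finset.sum_const, Finset.card_univ, nsmul_eq_mul, cs_card]
  ring

lemma cs_hash {K K' : ℕ} (hK' : 0 < K') {j k : Fin K} (h : j ≠ k) :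
    ∑ g : Fin K → Fin K', (if g j = g k then (1 : ℝ) else 0) = (K' : ℝ) ^ K / K' := by
  haveI : NeZero K' := ⟨hK'.ne'⟩
  have hc : ∀ c : Fin K', ∑ g : Fin K → Fin K', (if g j + c = g k then (1 : ℝ) else 0) =
      ∑ g : Fin K → Fin K', (if g j = g k then (1 : ℝ) else 0) := by
    intro c
    rw [← Equiv.sum_comp (Equiv.addRight (Pi.single j c : Fin K → Fin K'))
      (fun g => if g j = g k then (1 : ℝ) else 0)]
    simp [h.symm]
  have hs : ∑ c : Fin K', ∑ g : Fin K → Fin K', (if g j + c = g k then (1 : ℝ) else 0) =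
      (K' : ℝ) ^ K := by
    rw [Finset.sum_comm]
    have : ∀ g : Fin K → Fin K', ∑ c : Fin K', (if g j + c = g k then (1 : ℝ) else 0) = 1 := by
      intro g
      have : ∀ c, (g j + c = g k) ↔ c = g k - g j := by
        intro c
        rw [eq_sub_iff_add_eq, add_comm]
      simp [this]
    simp [this]
  simp only [hc] at hs
  have hne : (K' : ℝ) ≠ 0 := by positivity
  rw [eq_div_iff hne, ← hs]
  simp [mul_comm]

lemma cs_inner {K K' : ℕ} (h : Fin K → Fin K') (s : Fin K → CSSign) (x y : Fin K → ℝ) :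
    ∑ i : Fin K', ((sketchP K K' h (fun j => (s j : ℝ))).mulVec x) i *
        ((sketchP K K' h (fun j => (s j : ℝ))).mulVec y) i =
      (∑ j, x j * y j) + ∑ j, ∑ k,
        (if k = j then 0 else if h j = h k then x j * y k else 0) *
          ((s j : ℝ) * (s k : ℝ)) := by
  have e : ∑ i : Fin K', ((sketchP K K' h (fun j => (s j : ℝ))).mulVec x) i *
        ((sketchP K K' h (fun j => (s j : ℝ))).mulVec y) i =
      ∑ j, ∑ k, (if h j = h k then x j * y k else 0) * ((s j : ℝ) * (s k : ℝ)) := by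
    simp only [Matrix.mulVec, dotProduct, sketchP, Matrix.of_apply, Finset.sum_mul_sum]
    rw [Finset.sum_comm]
    refine Finset.sum_congr rfl fun j _ => ?_
    rw [Finset.sum_comm]
    refine Finset.sum_congr rfl fun k _ => ?_
    rw [Finset.sum_eq_single (h j)]
    · by_cases hh : h j = h k
      · simp [hh]; ring
      · simp [hh, Ne.symm hh]
    · intro b _ hb
      simp [hb.symm]
    · simp
  rw [e, ← Finset.sum_add_distrib]
  refine Finset.sum_congr rfl fun j _ => ?_
  have : x j * y j = ∑ k, if k = j then x j * y k else 0 := by simp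
  rw [this, ← Finset.sum_add_distrib]
  refine Finset.sum_congr rfl fun k _ => ?_
  by_cases hk : k = j
  · subst hk
    simp [csSign_sq]
  · simp [hk]

/-- exact second moment of the count sketch inner product. -/
theorem countSketch_inner_secondMoment (K K' : ℕ) (hK : 0 < K) (hK' : 0 < K')
    (x y : Fin K → ℝ) :
    sketchE K K' (fun h s =>
        (∑ i : Fin K', ((sketchP K K' h s).mulVec x) i * ((sketchP K K' h s).mulVec y) i) ^ 2) =
      (∑ j : Fin K, x j * y j) ^ 2 +
        (1 / (K' : ℝ)) *
          ∑ j : Fin K, ∑ k ∈ Finset.univ.filter (fun k : Fin K => k ≠ j),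
            (x j ^ 2 * y k ^ 2 + x j * y j * x k * y k) := by
  have hne : (K' : ℝ) ≠ 0 := by positivity
  unfold sketchE
  rw [Fintype.sum_prod_type]
  simp only [cs_inner]
  have step : ∀ h : Fin K → Fin K', ∑ s : Fin K → CSSign,
      ((∑ j, x j * y j) + ∑ j, ∑ k,
        (if k = j then 0 else if h j = h k then x j * y k else 0) *
          ((s j : ℝ) * (s k : ℝ))) ^ 2 =
      2 ^ K * ((∑ j, x j * y j) ^ 2 + ∑ j, ∑ k ∈ Finset.univ.filter (fun k : Fin K => k ≠ j),
        (x j ^ 2 * y k ^ 2 + x j * y j * x k * y k) * (if h j = h k then (1 : ℝ) else 0)) := by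
    intro h
    rw [cs_quad _ (fun j k => if k = j then 0 else if h j = h k then x j * y k else 0)
      (by simp)]
    congr 2
    refine Finset.sum_congr rfl fun j _ => ?_
    rw [Finset.sum_filter]
    refine Finset.sum_congr rfl fun k _ => ?_
    by_cases hk : k = j
    · simp [hk]
    · by_cases hh : h j = h k
      · simp [hk, Ne.symm hk, hh]; ring
      · simp [hk, hh]
  rw [Finset.sum_congr rfl (fun h _ => step h), ← Finset.mul_sum, Finset.sum_add_distrib]
  have step2 : ∑ h : Fin K → Fin K', ∑ j, ∑ k ∈ Finset.univ.filter (fun k : Fin K => k ≠ j),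
        (x j ^ 2 * y k ^ 2 + x j * y j * x k * y k) * (if h j = h k then (1 : ℝ) else 0) =
      (K' : ℝ) ^ K / K' * ∑ j : Fin K, ∑ k ∈ Finset.univ.filter (fun k : Fin K => k ≠ j),
            (x j ^ 2 * y k ^ 2 + x j * y j * x k * y k) := by
    rw [Finset.sum_comm, Finset.mul_sum]
    refine Finset.sum_congr rfl fun j _ => ?_
    rw [Finset.sum_comm, Finset.mul_sum]
    refine Finset.sum_congr rfl fun k hk => ?_
    rw [← Finset.mul_sum, cs_hash hK' (Ne.symm (Finset.mem_filter.mp hk).2), mul_comm]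
  rw [step2, Fintype.card_prod, Nat.cast_mul, cs_card, Finset.sum_const, Finset.card_univ,
    nsmul_eq_mul]
  have hcard : (Fintype.card (Fin K → Fin K') : ℝ) = (K' : ℝ) ^ K := by simp
  rw [hcard]
  have h3 : (K' : ℝ) ^ K ≠ 0 := pow_ne_zero _ hne
  field_simp
end

section
/- Exact variance of the count sketch inner product: for all vectors x, y ∈ ℝ^{K}, Var_{h,s}(⟨P(h,s).mulVec x, P(h,s).mulVec y⟩) = (1/K') ∑_{j ≠ k} (x_j² y_k² + x_j y_j x_k y_k), where the sum is over ordered pairs of distinct indices j, k in Fin K and Var(Z) := E[Z²] − (E[Z])². -/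
open Matrix BigOperators Finset

/-- Signs sum to zero if flipping coordinate `j` negates the summand. -/
lemma aux_flip (K : ℕ) (j : Fin K) (g : (Fin K → ℝ) → ℝ)
    (hg : ∀ s : Fin K → ℝ, g (fun i => if i = j then - s i else s i) = - g s) :
    ∑ s : Fin K → ({-1, 1} : Finset ℝ), g (fun i => (s i : ℝ)) = 0 := by
  have hneg : ∀ a : ({-1, 1} : Finset ℝ), -(a : ℝ) ∈ ({-1, 1} : Finset ℝ) := by
    rintro ⟨a, ha⟩
    simp only [Finset.mem_insert, Finset.mem_singleton] at ha ⊢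
    rcases ha with rfl | rfl <;> simp
  let n : ({-1, 1} : Finset ℝ) ≃ ({-1, 1} : Finset ℝ) :=
    ⟨fun a => ⟨-(a : ℝ), hneg a⟩, fun a => ⟨-(a : ℝ), hneg a⟩,
      fun a => by simp, fun a => by simp⟩
  let e : (Fin K → ({-1, 1} : Finset ℝ)) ≃ (Fin K → ({-1, 1} : Finset ℝ)) :=
    Equiv.piCongrRight (fun i => if i = j then n else Equiv.refl _)
  have h1 := Equiv.sum_comp e (fun s => g (fun i => (s i : ℝ)))
  have h2 : ∀ s, g (fun i => (e s i : ℝ)) = - g (fun i => (s i : ℝ)) := by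
    intro s
    rw [← hg]
    congr 1
    funext i
    by_cases hi : i = j <;> simp [e, n, hi]
  simp only [h2, Finset.sum_neg_distrib] at h1
  linarith

lemma aux_sq (K : ℕ) (s : Fin K → ({-1, 1} : Finset ℝ)) (i : Fin K) :
    (s i : ℝ) * (s i : ℝ) = 1 := by
  have h := (s i).2
  simp only [Finset.mem_insert, Finset.mem_singleton] at h
  rcases h with h | h <;> rw [h] <;> norm_num

lemma aux_s2 (K : ℕ) (j k : Fin K) (hjk : j ≠ k) :
    ∑ s : Fin K → ({-1, 1} : Finset ℝ), ((s j : ℝ) * (s k : ℝ)) = 0 := by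
  apply aux_flip K j (fun s => s j * s k)
  intro s
  simp [hjk.symm]

lemma aux_s4 (K : ℕ) (p q : Fin K × Fin K) (hp : p.1 ≠ p.2) (hq : q.1 ≠ q.2) :
    ∑ s : Fin K → ({-1, 1} : Finset ℝ),
      (((s p.1 : ℝ) * (s p.2 : ℝ)) * ((s q.1 : ℝ) * (s q.2 : ℝ))) =
    (Fintype.card (Fin K → ({-1, 1} : Finset ℝ)) : ℝ) *
      ((if q = p then 1 else 0) + (if q = p.swap then 1 else 0)) := by
  obtain ⟨j, k⟩ := p
  obtain ⟨l, m⟩ := q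
  simp only [Prod.swap_prod_mk, Prod.mk.injEq] at *
  by_cases h1 : l = j
  · subst h1
    by_cases h2 : m = k
    · subst h2
      have : ∀ s : Fin K → ({-1, 1} : Finset ℝ),
          ((s l : ℝ) * (s m : ℝ)) * ((s l : ℝ) * (s m : ℝ)) = 1 := by
        intro s
        rw [mul_mul_mul_comm, aux_sq, aux_sq, one_mul]
      simp only [this]
      simp [hp]
    · rw [aux_flip K k (fun s => (s l * s k) * (s l * s m))]
      · simp [h2, hp]
      · intro s
        simp [h2, hp]
  · by_cases h2 : m = j
    · subst h2
      by_cases h3 : l = k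
      · subst h3
        have : ∀ s : Fin K → ({-1, 1} : Finset ℝ),
            ((s m : ℝ) * (s l : ℝ)) * ((s l : ℝ) * (s m : ℝ)) = 1 := by
          intro s
          rw [mul_comm (s l : ℝ), mul_mul_mul_comm, aux_sq, aux_sq, one_mul]
        simp only [this]
        simp [hq]
      · rw [aux_flip K k (fun s => (s m * s k) * (s l * s m))]
        · simp [h3, hq]
        · intro s
          simp [h3, hp]
    · rw [aux_flip K j (fun s => (s j * s k) * (s l * s m))]
      · simp [h1, h2]
      · intro s
        simp [h1, h2, hp.symm]

lemma aux_h (K K' : ℕ) (hK' : 0 < K') (j k : Fin K) (hjk : j ≠ k) :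
    ∑ h : Fin K → Fin K', (if h j = h k then (1 : ℝ) else 0) =
      (Fintype.card (Fin K → Fin K') : ℝ) / K' := by
  have : NeZero K' := ⟨hK'.ne'⟩
  have h1 : ∀ c : Fin K', ∑ h : Fin K → Fin K', (if h j + c = h k then (1 : ℝ) else 0) =
      ∑ h : Fin K → Fin K', (if h j = h k then (1 : ℝ) else 0) := by
    intro c
    let e : (Fin K → Fin K') ≃ (Fin K → Fin K') :=
      Equiv.piCongrRight (fun i => if i = j then Equiv.addRight c else Equiv.refl _)
    rw [← Equiv.sum_comp e (fun h => if h j = h k then (1 : ℝ) else 0)]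
    apply Finset.sum_congr rfl
    intro h _
    simp [e, hjk.symm]
  have h2 : ∑ c : Fin K', ∑ h : Fin K → Fin K', (if h j + c = h k then (1 : ℝ) else 0) =
      (Fintype.card (Fin K → Fin K') : ℝ) := by
    rw [Finset.sum_comm]
    have : ∀ h : Fin K → Fin K', ∑ c : Fin K', (if h j + c = h k then (1 : ℝ) else 0) = 1 := by
      intro h
      have : ∀ c, (h j + c = h k) ↔ c = h k - h j := by
        intro c
        rw [eq_sub_iff_add_eq, add_comm]
      simp only [this]
      simp
    simp only [this]
    simp
  simp only [h1] at h2
  rw [← h2]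
  have : (K' : ℝ) ≠ 0 := by positivity
  simp
  field_simp

lemma aux_Z (K K' : ℕ) (x y : Fin K → ℝ) (h : Fin K → Fin K')
    (s : Fin K → ({-1, 1} : Finset ℝ)) :
    ∑ i : Fin K', ((sketchP K K' h (fun j => (s j : ℝ))).mulVec x) i *
      ((sketchP K K' h (fun j => (s j : ℝ))).mulVec y) i =
    ∑ j, x j * y j + ∑ p ∈ (Finset.univ : Finset (Fin K)).offDiag,
      (x p.1 * y p.2) * ((if h p.1 = h p.2 then 1 else 0) * ((s p.1 : ℝ) * (s p.2 : ℝ))) := by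
  have h0 : ∑ i : Fin K', ((sketchP K K' h (fun j => (s j : ℝ))).mulVec x) i *
      ((sketchP K K' h (fun j => (s j : ℝ))).mulVec y) i =
      ∑ p : Fin K × Fin K,
      (x p.1 * y p.2) * ((if h p.1 = h p.2 then 1 else 0) * ((s p.1 : ℝ) * (s p.2 : ℝ))) := by
    simp only [Matrix.mulVec, dotProduct, sketchP, Matrix.of_apply, Finset.sum_mul_sum]
    rw [Finset.sum_comm, Fintype.sum_prod_type]
    apply Finset.sum_congr rfl
    intro j _
    rw [Finset.sum_comm]
    apply Finset.sum_congr rfl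
    intro k _
    rw [Finset.sum_eq_single (h j)]
    · by_cases hh : h j = h k
      · simp [hh]; ring
      · simp [hh, Ne.symm hh]
    · intro b _ hb
      simp [hb.symm]
    · simp
  rw [h0, ← Finset.univ_product_univ, ← Finset.diag_union_offDiag,
    Finset.sum_union (Finset.disjoint_diag_offDiag _), Finset.sum_diag]
  simp [aux_sq]

lemma aux_W2 (K K' : ℕ) (hK' : 0 < K') (x y : Fin K → ℝ) :
    ∑ h : Fin K → Fin K', ∑ s : Fin K → ({-1, 1} : Finset ℝ),
      (∑ p ∈ (Finset.univ : Finset (Fin K)).offDiag,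
      (x p.1 * y p.2) * ((if h p.1 = h p.2 then 1 else 0) * ((s p.1 : ℝ) * (s p.2 : ℝ)))) ^ 2 =
    (Fintype.card (Fin K → Fin K') : ℝ) * (Fintype.card (Fin K → ({-1, 1} : Finset ℝ)) : ℝ) *
     ((1 / (K' : ℝ)) * ∑ p ∈ (Finset.univ : Finset (Fin K)).offDiag,
      (x p.1 ^ 2 * y p.2 ^ 2 + x p.1 * y p.1 * x p.2 * y p.2)) := by
  have key : ∀ h : Fin K → Fin K', ∑ s : Fin K → ({-1, 1} : Finset ℝ),
      (∑ p ∈ (Finset.univ : Finset (Fin K)).offDiag,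
      (x p.1 * y p.2) * ((if h p.1 = h p.2 then 1 else 0) * ((s p.1 : ℝ) * (s p.2 : ℝ)))) ^ 2 =
      ∑ p ∈ (Finset.univ : Finset (Fin K)).offDiag, (if h p.1 = h p.2 then (1 : ℝ) else 0) *
        ((Fintype.card (Fin K → ({-1, 1} : Finset ℝ)) : ℝ) *
        (x p.1 ^ 2 * y p.2 ^ 2 + x p.1 * y p.1 * x p.2 * y p.2)) := by
    intro h
    simp only [sq (Finset.sum _ _), Finset.sum_mul_sum]
    rw [Finset.sum_comm]
    apply Finset.sum_congr rfl
    intro p hp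
    rw [Finset.sum_comm]
    have hp' : p.1 ≠ p.2 := by simpa using hp
    have hsw : p.swap ∈ (Finset.univ : Finset (Fin K)).offDiag := by
      simpa using hp'.symm
    have step : ∀ q ∈ (Finset.univ : Finset (Fin K)).offDiag,
        ∑ s : Fin K → ({-1, 1} : Finset ℝ),
        (x p.1 * y p.2) * ((if h p.1 = h p.2 then 1 else 0) * ((s p.1 : ℝ) * (s p.2 : ℝ))) *
        ((x q.1 * y q.2) * ((if h q.1 = h q.2 then 1 else 0) * ((s q.1 : ℝ) * (s q.2 : ℝ)))) =
        (if q = p then (x p.1 * y p.2) * (x q.1 * y q.2) * (if h p.1 = h p.2 then 1 else 0) *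
          (if h q.1 = h q.2 then 1 else 0) *
          (Fintype.card (Fin K → ({-1, 1} : Finset ℝ)) : ℝ) else 0) +
        (if q = p.swap then (x p.1 * y p.2) * (x q.1 * y q.2) *
          (if h p.1 = h p.2 then 1 else 0) * (if h q.1 = h q.2 then 1 else 0) *
          (Fintype.card (Fin K → ({-1, 1} : Finset ℝ)) : ℝ) else 0) := by
      intro q hq
      have hq' : q.1 ≠ q.2 := by simpa using hq
      have h4 := aux_s4 K p q hp' hq'
      trans ((x p.1 * y p.2) * (x q.1 * y q.2) * (if h p.1 = h p.2 then 1 else 0) *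
          (if h q.1 = h q.2 then 1 else 0)) * ∑ s : Fin K → ({-1, 1} : Finset ℝ),
        (((s p.1 : ℝ) * (s p.2 : ℝ)) * ((s q.1 : ℝ) * (s q.2 : ℝ)))
      · rw [Finset.mul_sum]
        apply Finset.sum_congr rfl
        intro s _
        ring
      · rw [h4]
        simp only [mul_add, mul_ite, mul_one, mul_zero, ite_mul, zero_mul]
    rw [Finset.sum_congr rfl step, Finset.sum_add_distrib, Finset.sum_ite_eq',
      Finset.sum_ite_eq', if_pos hp, if_pos hsw]
    by_cases hh : h p.1 = h p.2
    · simp only [hh, Prod.fst_swap, Prod.snd_swap, if_true]; ring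
    · simp [hh]
  simp only [key]
  rw [Finset.sum_comm, Finset.mul_sum, Finset.mul_sum]
  apply Finset.sum_congr rfl
  intro p hp
  have hp' : p.1 ≠ p.2 := by simpa using hp
  rw [← Finset.sum_mul, aux_h K K' hK' _ _ hp']
  ring

lemma aux_W1 (K K' : ℕ) (x y : Fin K → ℝ) :
    ∑ h : Fin K → Fin K', ∑ s : Fin K → ({-1, 1} : Finset ℝ),
      (∑ p ∈ (Finset.univ : Finset (Fin K)).offDiag,
      (x p.1 * y p.2) * ((if h p.1 = h p.2 then 1 else 0) * ((s p.1 : ℝ) * (s p.2 : ℝ)))) = 0 := by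
  apply Finset.sum_eq_zero
  intro h _
  rw [Finset.sum_comm]
  apply Finset.sum_eq_zero
  intro p hp
  have hp' : p.1 ≠ p.2 := by simpa using hp
  rw [← Finset.mul_sum, ← Finset.mul_sum, aux_s2 K _ _ hp']
  simp

lemma aux_rhs (K : ℕ) (f : Fin K → Fin K → ℝ) :
    ∑ j : Fin K, ∑ k ∈ Finset.univ.filter (fun k : Fin K => k ≠ j), f j k =
    ∑ p ∈ (Finset.univ : Finset (Fin K)).offDiag, f p.1 p.2 := by
  rw [Finset.sum_sigma']
  refine Finset.sum_bij' (fun a _ => (a.1, a.2)) (fun p _ => ⟨p.1, p.2⟩) ?_ ?_ ?_ ?_ ?_ <;>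
    simp +contextual [eq_comm]

/-- exact variance of the count sketch inner product. -/
theorem countSketch_inner_variance (K K' : ℕ) (hK : 0 < K) (hK' : 0 < K')
    (x y : Fin K → ℝ) :
    sketchVar K K' (fun h s =>
        ∑ i : Fin K', ((sketchP K K' h s).mulVec x) i * ((sketchP K K' h s).mulVec y) i) =
      (1 / (K' : ℝ)) *
        ∑ j : Fin K, ∑ k ∈ Finset.univ.filter (fun k : Fin K => k ≠ j),
          (x j ^ 2 * y k ^ 2 + x j * y j * x k * y k) := by
  rw [aux_rhs K (fun j k => x j ^ 2 * y k ^ 2 + x j * y j * x k * y k)]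
  have : NeZero K' := ⟨hK'.ne'⟩
  have : Nonempty ({-1, 1} : Finset ℝ) := ⟨⟨1, by simp⟩⟩
  have hH : (Fintype.card (Fin K → Fin K') : ℝ) ≠ 0 := by
    exact_mod_cast Fintype.card_ne_zero
  have hS : (Fintype.card (Fin K → ({-1, 1} : Finset ℝ)) : ℝ) ≠ 0 := by
    exact Nat.cast_ne_zero.mpr Fintype.card_ne_zero
  have h1 := aux_W1 K K' x y
  have h2 := aux_W2 K K' hK' x y
  unfold sketchVar sketchE
  simp only [aux_Z, Fintype.sum_prod_type, add_sq, Finset.sum_add_distrib, ← Finset.mul_sum, h1, h2,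
    Fintype.card_prod, Nat.cast_mul, Finset.sum_const, Finset.card_univ, nsmul_eq_mul]
  generalize (Fintype.card (Fin K → Fin K') : ℝ) = H at *
  generalize (Fintype.card (Fin K → ({-1, 1} : Finset ℝ)) : ℝ) = S at *
  field_simp
  ring
end

section
/- Variance bound for the count sketch inner product (Property 1, second part): for all vectors x, y ∈ ℝ^{K}, Var_{h,s}(⟨P(h,s).mulVec x, P(h,s).mulVec y⟩) ≤ (1/K') (⟨x,y⟩² + ‖x‖² ‖y‖²), where Var(Z) := E[Z²] − (E[Z])² and ‖·‖ is the Euclidean norm. -/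
open Matrix BigOperators Finset

/-- Sign flip on the two-element type of signs. -/
noncomputable def cs_neg : ({-1, 1} : Finset ℝ) ≃ ({-1, 1} : Finset ℝ) :=
  Function.Involutive.toPerm
    (fun a => ⟨-(a : ℝ), by
      have h := a.2
      simp only [Finset.mem_insert, Finset.mem_singleton] at h ⊢
      rcases h with h | h <;> rw [h] <;> norm_num⟩)
    (fun a => by ext; simp)

lemma cs_neg_val (a : ({-1, 1} : Finset ℝ)) : ((cs_neg a : ({-1, 1} : Finset ℝ)) : ℝ) = -(a : ℝ) := rfl

lemma cs_sq (a : ({-1, 1} : Finset ℝ)) : (a : ℝ) * (a : ℝ) = 1 := by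
  have h := a.2
  simp only [Finset.mem_insert, Finset.mem_singleton] at h
  rcases h with h | h <;> rw [h] <;> norm_num

lemma cs_sum_zero_s16 {K : ℕ} (j k l m : Fin K) (hk : k ≠ j) (hl : l ≠ j) (hm : m ≠ j) :
    ∑ s : Fin K → ({-1, 1} : Finset ℝ), (s j : ℝ) * s k * s l * s m = 0 := by
  have h := Equiv.sum_comp
    (Equiv.piCongrRight (fun i : Fin K => if i = j then cs_neg else Equiv.refl _))
    (fun s : Fin K → ({-1, 1} : Finset ℝ) => (s j : ℝ) * s k * s l * s m)
  simp only [Equiv.piCongrRight_apply, Pi.map_apply, if_pos, if_neg hk, if_neg hl, if_neg hm,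
    cs_neg_val, Equiv.refl_apply, neg_mul, Finset.sum_neg_distrib] at h
  linarith

lemma cs_sum_four {K : ℕ} (j k l m : Fin K) (hjk : j ≠ k) (hlm : l ≠ m) :
    ∑ s : Fin K → ({-1, 1} : Finset ℝ), (s j : ℝ) * s k * s l * s m =
      (Fintype.card (Fin K → ({-1, 1} : Finset ℝ)) : ℝ) *
        ((if j = l ∧ k = m then 1 else 0) + (if j = m ∧ k = l then 1 else 0)) := by
  by_cases h1 : j = l ∧ k = m
  · obtain ⟨rfl, rfl⟩ := h1
    have h2 : ¬ (j = k ∧ k = j) := fun h => hjk h.1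
    rw [if_pos ⟨rfl, rfl⟩, if_neg h2]
    have : ∀ s : Fin K → ({-1, 1} : Finset ℝ), (s j : ℝ) * s k * s j * s k = 1 := by
      intro s
      linear_combination ((s k : ℝ) * s k) * cs_sq (s j) + cs_sq (s k)
    simp only [this, Finset.sum_const, Finset.card_univ]
    simp
  by_cases h2 : j = m ∧ k = l
  · obtain ⟨rfl, rfl⟩ := h2
    rw [if_neg h1, if_pos ⟨rfl, rfl⟩]
    have : ∀ s : Fin K → ({-1, 1} : Finset ℝ), (s j : ℝ) * s k * s k * s j = 1 := by
      intro s
      linear_combination ((s k : ℝ) * s k) * cs_sq (s j) + cs_sq (s k)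
    simp only [this, Finset.sum_const, Finset.card_univ]
    simp
  rw [if_neg h1, if_neg h2, add_zero, mul_zero]
  by_cases hj : l ≠ j ∧ m ≠ j
  · exact cs_sum_zero_s16 j k l m hjk.symm hj.1 hj.2
  · rw [← cs_sum_zero_s16 k j l m hjk (by grind) (by grind)]
    refine Finset.sum_congr rfl fun s _ => ?_
    ring

lemma cs_sum_hash {K K' : ℕ} (hK' : 0 < K') (j k : Fin K) (hjk : j ≠ k) :
    ∑ h : Fin K → Fin K', (if h j = h k then (1 : ℝ) else 0) =
      (Fintype.card (Fin K → Fin K') : ℝ) / K' := by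
  have : NeZero K' := ⟨hK'.ne'⟩
  have key : ∀ c : Fin K', ∑ h : Fin K → Fin K', (if h j + c = h k then (1 : ℝ) else 0) =
      ∑ h : Fin K → Fin K', (if h j = h k then (1 : ℝ) else 0) := by
    intro c
    have h := Equiv.sum_comp
      (Equiv.piCongrRight (fun i : Fin K => if i = j then Equiv.addRight c else Equiv.refl _))
      (fun h : Fin K → Fin K' => (if h j = h k then (1 : ℝ) else 0))
    simpa only [Equiv.piCongrRight_apply, Pi.map_apply, if_pos, if_neg hjk.symm,
      Equiv.coe_addRight, Equiv.refl_apply] using h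
  have h2 : ∑ c : Fin K', ∑ h : Fin K → Fin K', (if h j + c = h k then (1 : ℝ) else 0) =
      (Fintype.card (Fin K → Fin K') : ℝ) := by
    rw [Finset.sum_comm]
    have : ∀ h : Fin K → Fin K', ∑ c : Fin K', (if h j + c = h k then (1 : ℝ) else 0) = 1 := by
      intro h
      have e : ∀ c, (h j + c = h k) ↔ (c = h k - h j) := fun c => by
        rw [eq_sub_iff_add_eq, add_comm]
      simp [e]
    simp only [this, Finset.sum_const, Finset.card_univ]
    simp
  simp only [key, Finset.sum_const, Finset.card_univ, Fintype.card_fin, nsmul_eq_mul] at h2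
  have : (K' : ℝ) ≠ 0 := by exact_mod_cast hK'.ne'
  field_simp
  linarith

/-- Off-diagonal part of the sketched inner product. -/
noncomputable def cs_W {K K' : ℕ} (x y : Fin K → ℝ) (h : Fin K → Fin K') (s : Fin K → ℝ) : ℝ :=
  ∑ p ∈ (univ : Finset (Fin K × Fin K)).filter (fun p => p.1 ≠ p.2),
    (if h p.1 = h p.2 then 1 else 0) * (s p.1 * s p.2 * (x p.1 * y p.2))

lemma cs_Z {K K' : ℕ} (x y : Fin K → ℝ) (h : Fin K → Fin K') (s : Fin K → ℝ)
    (hs : ∀ j, s j * s j = 1) :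
    ∑ i : Fin K', ((sketchP K K' h s).mulVec x) i * ((sketchP K K' h s).mulVec y) i =
      ∑ j, x j * y j + cs_W x y h s := by
  have h1 : ∑ i : Fin K', ((sketchP K K' h s).mulVec x) i * ((sketchP K K' h s).mulVec y) i =
      ∑ p : Fin K × Fin K,
        (if h p.1 = h p.2 then 1 else 0) * (s p.1 * s p.2 * (x p.1 * y p.2)) := by
    simp only [Matrix.mulVec, dotProduct, sketchP, Matrix.of_apply, Finset.sum_mul_sum,
      Fintype.sum_prod_type]
    rw [Finset.sum_comm]
    refine Finset.sum_congr rfl fun j _ => ?_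
    rw [Finset.sum_comm]
    refine Finset.sum_congr rfl fun k _ => ?_
    rw [Finset.sum_eq_single (h j)]
    · by_cases e : h j = h k
      · simp [e]; ring
      · simp [e, Ne.symm e]
    · intro b _ hb
      simp [Ne.symm hb]
    · simp
  rw [h1, ← Finset.sum_filter_add_sum_filter_not univ (fun p : Fin K × Fin K => p.1 = p.2)]
  congr 1
  rw [Finset.sum_filter, Fintype.sum_prod_type]
  refine Finset.sum_congr rfl fun j _ => ?_
  simp [hs]

lemma cs_W_sq {K K' : ℕ} (hK' : 0 < K') (x y : Fin K → ℝ) :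
    ∑ ω : (Fin K → Fin K') × (Fin K → ({-1, 1} : Finset ℝ)),
      (cs_W x y ω.1 (fun j => (ω.2 j : ℝ))) ^ 2 =
    (Fintype.card ((Fin K → Fin K') × (Fin K → ({-1, 1} : Finset ℝ))) : ℝ) / K' *
      ∑ p ∈ (univ : Finset (Fin K × Fin K)).filter (fun p => p.1 ≠ p.2),
        ((x p.1 * y p.2) ^ 2 + (x p.1 * y p.2) * (x p.2 * y p.1)) := by
  set D := (univ : Finset (Fin K × Fin K)).filter (fun p => p.1 ≠ p.2) with hD
  have hs : ∀ h : Fin K → Fin K', ∑ s : Fin K → ({-1, 1} : Finset ℝ),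
      (cs_W x y h (fun j => (s j : ℝ))) ^ 2 =
      ∑ p ∈ D, (if h p.1 = h p.2 then (1 : ℝ) else 0) *
        ((Fintype.card (Fin K → ({-1, 1} : Finset ℝ)) : ℝ) *
        ((x p.1 * y p.2) ^ 2 + (x p.1 * y p.2) * (x p.2 * y p.1))) := by
    intro h
    simp only [cs_W, sq (Finset.sum _ _), Finset.sum_mul_sum]
    rw [Finset.sum_comm]
    refine Finset.sum_congr rfl fun p hp => ?_
    rw [Finset.sum_comm]
    have hp' : p.1 ≠ p.2 := by simpa [hD] using hp
    have step : ∀ q ∈ D, ∑ s : Fin K → ({-1, 1} : Finset ℝ),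
        ((if h p.1 = h p.2 then (1 : ℝ) else 0) * ((s p.1 : ℝ) * s p.2 * (x p.1 * y p.2))) *
        ((if h q.1 = h q.2 then (1 : ℝ) else 0) * ((s q.1 : ℝ) * s q.2 * (x q.1 * y q.2))) =
        (if p = q then (if h p.1 = h p.2 then (1 : ℝ) else 0) *
          (Fintype.card (Fin K → ({-1, 1} : Finset ℝ)) : ℝ) * (x p.1 * y p.2) ^ 2 else 0) +
        (if p.swap = q then (if h p.1 = h p.2 then (1 : ℝ) else 0) *
          (Fintype.card (Fin K → ({-1, 1} : Finset ℝ)) : ℝ) *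
            ((x p.1 * y p.2) * (x p.2 * y p.1)) else 0) := by
      intro q hq
      have hq' : q.1 ≠ q.2 := by simpa [hD] using hq
      have e := cs_sum_four p.1 p.2 q.1 q.2 hp' hq'
      trans ((if h p.1 = h p.2 then (1 : ℝ) else 0) * (if h q.1 = h q.2 then (1 : ℝ) else 0) *
        (x p.1 * y p.2) * (x q.1 * y q.2)) *
        ∑ s : Fin K → ({-1, 1} : Finset ℝ), (s p.1 : ℝ) * s p.2 * s q.1 * s q.2
      · rw [Finset.mul_sum]
        refine Finset.sum_congr rfl fun s _ => ?_
        ring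
      rw [e]
      obtain ⟨j, k⟩ := p
      obtain ⟨l, m⟩ := q
      simp only [Prod.swap, Prod.mk.injEq] at *
      rw [mul_add, mul_add]
      congr 1
      · by_cases c : j = l ∧ k = m
        · obtain ⟨rfl, rfl⟩ := c
          by_cases e : h j = h k <;> simp [e]
          ring
        · simp [c]
      · by_cases c : j = m ∧ k = l
        · obtain ⟨rfl, rfl⟩ := c
          by_cases e : h j = h k <;> simp [e]
          ring
        · have c' : ¬ (k = l ∧ j = m) := fun t => c ⟨t.2, t.1⟩
          simp [c, c']
    have hsw : p.swap ∈ D := by simpa [hD] using hp'.symm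
    rw [Finset.sum_congr rfl step, Finset.sum_add_distrib, Finset.sum_ite_eq, Finset.sum_ite_eq,
      if_pos hp, if_pos hsw]
    ring
  rw [Fintype.sum_prod_type]
  simp only [hs]
  rw [Finset.sum_comm, Finset.mul_sum]
  refine Finset.sum_congr rfl fun p hp => ?_
  have hp' : p.1 ≠ p.2 := by simpa [hD] using hp
  rw [← Finset.sum_mul, cs_sum_hash hK' _ _ hp', Fintype.card_prod, Nat.cast_mul]
  ring

lemma cs_Q_le {K : ℕ} (x y : Fin K → ℝ) :
    ∑ p ∈ (univ : Finset (Fin K × Fin K)).filter (fun p => p.1 ≠ p.2),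
        ((x p.1 * y p.2) ^ 2 + (x p.1 * y p.2) * (x p.2 * y p.1)) ≤
    (∑ j : Fin K, x j * y j) ^ 2 + (∑ j : Fin K, x j ^ 2) * (∑ j : Fin K, y j ^ 2) := by
  have h : (∑ j : Fin K, x j * y j) ^ 2 + (∑ j : Fin K, x j ^ 2) * (∑ j : Fin K, y j ^ 2) =
      ∑ p : Fin K × Fin K, ((x p.1 * y p.2) ^ 2 + (x p.1 * y p.2) * (x p.2 * y p.1)) := by
    rw [sq (Finset.sum _ _), Finset.sum_mul_sum, Finset.sum_mul_sum, Fintype.sum_prod_type,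
      ← Finset.sum_add_distrib]
    refine Finset.sum_congr rfl fun j _ => ?_
    rw [← Finset.sum_add_distrib]
    refine Finset.sum_congr rfl fun k _ => ?_
    ring
  rw [h, ← Finset.sum_filter_add_sum_filter_not univ (fun p : Fin K × Fin K => p.1 ≠ p.2)]
  refine le_add_of_nonneg_right (Finset.sum_nonneg fun p hp => ?_)
  have : p.1 = p.2 := by simpa using hp
  rw [this, ← sq]
  positivity

/-- variance bound for the count sketch inner product:
`Var(⟨Px, Py⟩) ≤ (1/K')(⟨x,y⟩² + ‖x‖²‖y‖²)`. -/
theorem countSketch_inner_variance_bound (K K' : ℕ) (hK : 0 < K) (hK' : 0 < K')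
    (x y : Fin K → ℝ) :
    sketchVar K K' (fun h s =>
        ∑ i : Fin K', ((sketchP K K' h s).mulVec x) i * ((sketchP K K' h s).mulVec y) i) ≤
      (1 / (K' : ℝ)) *
        ((∑ j : Fin K, x j * y j) ^ 2 + (∑ j : Fin K, x j ^ 2) * (∑ j : Fin K, y j ^ 2)) := by
  have hW := cs_W_sq hK' x y
  have hQ := cs_Q_le x y
  have hZ : ∀ ω : (Fin K → Fin K') × (Fin K → ({-1, 1} : Finset ℝ)), _ :=
    fun ω => cs_Z x y ω.1 (fun j => (ω.2 j : ℝ)) (fun j => cs_sq _)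
  unfold sketchVar sketchE
  simp only [hZ]
  set c := ∑ j : Fin K, x j * y j
  have hN : (0 : ℝ) < (Fintype.card ((Fin K → Fin K') × (Fin K → ({-1, 1} : Finset ℝ))) : ℝ) := by
    have : Nonempty (Fin K') := ⟨⟨0, hK'⟩⟩
    have : Nonempty ({-1, 1} : Finset ℝ) := ⟨⟨1, by simp⟩⟩
    exact Nat.cast_pos.mpr Fintype.card_pos
  simp only [add_sq, Finset.sum_add_distrib, ← Finset.mul_sum, Finset.sum_const, Finset.card_univ,
    nsmul_eq_mul]
  rw [hW]
  set N := (Fintype.card ((Fin K → Fin K') × (Fin K → ({-1, 1} : Finset ℝ))) : ℝ)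
  have hK0 : (0 : ℝ) < K' := by exact_mod_cast hK'
  refine le_trans ?_ (mul_le_mul_of_nonneg_left hQ (by positivity))
  generalize (∑ ω : (Fin K → Fin K') × (Fin K → ({-1, 1} : Finset ℝ)),
      cs_W x y ω.1 (fun j => (ω.2 j : ℝ))) = T
  generalize (∑ p ∈ (univ : Finset (Fin K × Fin K)).filter (fun p => p.1 ≠ p.2),
        ((x p.1 * y p.2) ^ 2 + (x p.1 * y p.2) * (x p.2 * y p.1))) = Q
  have : (N * c ^ 2 + 2 * c * T + N / K' * Q) / N - ((N * c + T) / N) ^ 2 =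
      1 / K' * Q - (T / N) ^ 2 := by
    field_simp
    ring
  rw [this]
  nlinarith [sq_nonneg (T / N)]
end

section
/- Variance of the sketched squared norm: for every vector x ∈ ℝ^{K}, Var_{h,s}(‖P(h,s).mulVec x‖²) = (2/K') ∑_{j ≠ k} x_j² x_k², where the sum is over ordered pairs of distinct indices j, k in Fin K; in particular this variance is at most (2/K') ‖x‖⁴. -/
open Matrix BigOperators Finset

lemma skE_add (K K' : ℕ) (f g : (Fin K → Fin K') → (Fin K → ℝ) → ℝ) :
    sketchE K K' (fun h s => f h s + g h s) = sketchE K K' f + sketchE K K' g := by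
  unfold sketchE
  rw [Finset.sum_add_distrib, add_div]

lemma skE_mul (K K' : ℕ) (c : ℝ) (f : (Fin K → Fin K') → (Fin K → ℝ) → ℝ) :
    sketchE K K' (fun h s => c * f h s) = c * sketchE K K' f := by
  unfold sketchE
  rw [← Finset.mul_sum, mul_div_assoc]

lemma skE_sum (K K' : ℕ) {ι : Type*} (t : Finset ι)
    (f : ι → (Fin K → Fin K') → (Fin K → ℝ) → ℝ) :
    sketchE K K' (fun h s => ∑ p ∈ t, f p h s) = ∑ p ∈ t, sketchE K K' (f p) := by
  unfold sketchE
  rw [Finset.sum_comm, Finset.sum_div]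

lemma sk_card_ne (K K' : ℕ) (hK' : 0 < K') :
    (Fintype.card ((Fin K → Fin K') × (Fin K → ({-1, 1} : Finset ℝ))) : ℝ) ≠ 0 := by
  have : Nonempty (Fin K') := ⟨⟨0, hK'⟩⟩
  have : Nonempty ({-1, 1} : Finset ℝ) := ⟨⟨1, by simp⟩⟩
  exact Nat.cast_ne_zero.mpr Fintype.card_ne_zero

lemma skE_const (K K' : ℕ) (hK' : 0 < K') (c : ℝ) :
    sketchE K K' (fun _ _ => c) = c := by
  unfold sketchE
  have := sk_card_ne K K' hK'
  rw [Finset.sum_const, nsmul_eq_mul, Finset.card_univ]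
  field_simp

lemma skE_congr (K K' : ℕ) (f g : (Fin K → Fin K') → (Fin K → ℝ) → ℝ)
    (H : ∀ h s, (∀ j, s j * s j = 1) → f h s = g h s) :
    sketchE K K' f = sketchE K K' g := by
  unfold sketchE
  congr 1
  refine Finset.sum_congr rfl fun ω _ => H _ _ fun j => ?_
  have := (ω.2 j).2
  simp only [Finset.mem_insert, Finset.mem_singleton] at this
  rcases this with h | h <;> rw [h] <;> norm_num

/-- negation on the sign set -/
def skNeg (a : ({-1, 1} : Finset ℝ)) : ({-1, 1} : Finset ℝ) :=
  ⟨-a.1, by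
    have := a.2
    simp only [Finset.mem_insert, Finset.mem_singleton] at this ⊢
    rcases this with h | h <;> rw [h] <;> norm_num⟩

lemma skE_odd (K K' : ℕ) (f : (Fin K → Fin K') → (Fin K → ℝ) → ℝ) (a : Fin K)
    (H : ∀ h s, f h (Function.update s a (-s a)) = - f h s) :
    sketchE K K' f = 0 := by
  unfold sketchE
  let e : (Fin K → Fin K') × (Fin K → ({-1, 1} : Finset ℝ)) →
      (Fin K → Fin K') × (Fin K → ({-1, 1} : Finset ℝ)) :=
    fun ω => (ω.1, Function.update ω.2 a (skNeg (ω.2 a)))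
  have he : Function.Involutive e := by
    intro ω
    simp [e, skNeg]
  have h1 := Equiv.sum_comp (Function.Involutive.toPerm e he)
    (fun ω : (Fin K → Fin K') × (Fin K → ({-1, 1} : Finset ℝ)) =>
      f ω.1 (fun j => (ω.2 j : ℝ)))
  have h2 : ∀ ω, f ((Function.Involutive.toPerm e he) ω).1
      (fun j => (((Function.Involutive.toPerm e he) ω).2 j : ℝ)) =
      - f ω.1 (fun j => (ω.2 j : ℝ)) := by
    intro ω
    rw [← H]
    congr 1
    funext j
    by_cases hj : j = a
    · subst hj; simp [e, skNeg]
    · simp [e, hj]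
  simp only [h2, Finset.sum_neg_distrib] at h1
  have h3 : (∑ ω : (Fin K → Fin K') × (Fin K → ({-1, 1} : Finset ℝ)),
      f ω.1 (fun j => (ω.2 j : ℝ))) = 0 := by linarith
  rw [h3, zero_div]

lemma skE_coll (K K' : ℕ) (hK' : 0 < K') (j k : Fin K) (hjk : j ≠ k) :
    sketchE K K' (fun h _ => if h j = h k then 1 else 0) = 1 / (K' : ℝ) := by
  have : NeZero K' := ⟨hK'.ne'⟩
  have h1 : ∀ c : Fin K', sketchE K K' (fun h _ => if h j = h k then 1 else 0) =
      sketchE K K' (fun h _ => if c = h k - h j then 1 else 0) := by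
    intro c
    unfold sketchE
    congr 1
    have := Equiv.sum_comp ((Equiv.addRight (Pi.single j c : Fin K → Fin K')).prodCongr
      (Equiv.refl (Fin K → ({-1, 1} : Finset ℝ))))
      (fun ω => if ω.1 j = ω.1 k then (1 : ℝ) else 0)
    rw [← this]
    refine Finset.sum_congr rfl fun ω _ => ?_
    simp [Pi.single_eq_of_ne hjk.symm, eq_sub_iff_add_eq, add_comm]
  have h2 : ∑ c : Fin K', sketchE K K' (fun h _ => if h j = h k then 1 else 0) = 1 := by
    rw [Finset.sum_congr rfl fun c _ => h1 c, ← skE_sum]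
    simp only [Finset.sum_ite_eq', Finset.mem_univ, if_true]
    simpa using skE_const K K' hK' 1
  rw [Finset.sum_const, nsmul_eq_mul, Finset.card_univ, Fintype.card_fin] at h2
  have : (K' : ℝ) ≠ 0 := by exact_mod_cast hK'.ne'
  field_simp
  linarith

/-- off-diagonal term -/
noncomputable def skT (K K' : ℕ) (x : Fin K → ℝ) (p : Fin K × Fin K)
    (h : Fin K → Fin K') (s : Fin K → ℝ) : ℝ :=
  x p.1 * x p.2 * ((if h p.1 = h p.2 then 1 else 0) * (s p.1 * s p.2))

lemma skT_swap (K K' : ℕ) (x : Fin K → ℝ) (p : Fin K × Fin K)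
    (h : Fin K → Fin K') (s : Fin K → ℝ) : skT K K' x p.swap h s = skT K K' x p h s := by
  simp only [skT, Prod.fst_swap, Prod.snd_swap, eq_comm (a := h p.2)]
  ring

lemma skE_T (K K' : ℕ) (x : Fin K → ℝ) (p : Fin K × Fin K) (hp : p.1 ≠ p.2) :
    sketchE K K' (skT K K' x p) = 0 := by
  apply skE_odd K K' _ p.1
  intro h s
  simp [skT, hp.symm]

lemma skE_TT_self (K K' : ℕ) (hK' : 0 < K') (x : Fin K → ℝ) (p : Fin K × Fin K)
    (hp : p.1 ≠ p.2) :
    sketchE K K' (fun h s => skT K K' x p h s * skT K K' x p h s) =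
      x p.1 ^ 2 * x p.2 ^ 2 / K' := by
  rw [skE_congr K K' _
    (fun h s => (x p.1 ^ 2 * x p.2 ^ 2) * (if h p.1 = h p.2 then 1 else 0)),
    skE_mul, skE_coll K K' hK' _ _ hp]
  · ring
  · intro h s hs
    have h1 := hs p.1
    have h2 := hs p.2
    unfold skT
    split_ifs
    · linear_combination (x p.1 ^ 2 * x p.2 ^ 2) * (s p.2 * s p.2) * h1 +
        (x p.1 ^ 2 * x p.2 ^ 2) * h2
    · ring

lemma skE_TT_ne (K K' : ℕ) (x : Fin K → ℝ) (p q : Fin K × Fin K)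
    (hp : p.1 ≠ p.2) (hq : q.1 ≠ q.2) (h1 : q ≠ p) (h2 : q ≠ p.swap) :
    sketchE K K' (fun h s => skT K K' x p h s * skT K K' x q h s) = 0 := by
  obtain ⟨j, k⟩ := p
  obtain ⟨l, m⟩ := q
  simp only [Prod.swap_prod_mk, ne_eq, Prod.mk.injEq, not_and] at *
  by_cases hj : l ≠ j ∧ m ≠ j
  · apply skE_odd K K' _ j
    intro h s
    simp [skT, hj.1, hj.2, Ne.symm hp]
    split_ifs <;> simp
  · have hk : l ≠ k ∧ m ≠ k := by grind
    apply skE_odd K K' _ k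
    intro h s
    simp [skT, hk.1, hk.2, hp]
    split_ifs <;> simp

lemma sk_expand (K K' : ℕ) (x : Fin K → ℝ) (h : Fin K → Fin K') (s : Fin K → ℝ)
    (hs : ∀ j, s j * s j = 1) :
    ∑ i : Fin K', ((sketchP K K' h s).mulVec x) i ^ 2 =
      ∑ j, x j ^ 2 + ∑ p ∈ (Finset.univ : Finset (Fin K)).offDiag, skT K K' x p h s := by
  have h1 : ∑ i : Fin K', ((sketchP K K' h s).mulVec x) i ^ 2 =
      ∑ p ∈ (Finset.univ : Finset (Fin K)) ×ˢ Finset.univ, skT K K' x p h s := by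
    rw [Finset.sum_product]
    simp only [Matrix.mulVec, dotProduct, sketchP, Matrix.of_apply, pow_two,
      Finset.sum_mul_sum]
    rw [Finset.sum_comm]
    refine Finset.sum_congr rfl fun j _ => ?_
    rw [Finset.sum_comm]
    refine Finset.sum_congr rfl fun k _ => ?_
    rw [Finset.sum_eq_single (h j)]
    · simp only [skT, eq_comm (a := h k)]
      split_ifs <;> ring
    · intro b _ hb
      simp [hb.symm]
    · simp
  rw [h1, ← Finset.diag_union_offDiag, Finset.sum_union (Finset.disjoint_diag_offDiag _),
    Finset.sum_diag]
  congr 1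
  refine Finset.sum_congr rfl fun j _ => ?_
  simp only [skT, if_true, hs j]
  ring

lemma sk_var (K K' : ℕ) (hK' : 0 < K') (x : Fin K → ℝ) :
    sketchVar K K' (fun h s => ∑ i : Fin K', ((sketchP K K' h s).mulVec x) i ^ 2) =
      (2 / (K' : ℝ)) *
        ∑ p ∈ (Finset.univ : Finset (Fin K)).offDiag, x p.1 ^ 2 * x p.2 ^ 2 := by
  set S := ∑ j, x j ^ 2 with hS
  set D := (Finset.univ : Finset (Fin K)).offDiag with hD
  have hDne : ∀ p ∈ D, p.1 ≠ p.2 := fun p hp => by simpa [hD] using hp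
  have hT : sketchE K K' (fun h s => ∑ p ∈ D, skT K K' x p h s) = 0 := by
    rw [skE_sum]
    exact Finset.sum_eq_zero fun p hp => skE_T K K' x p (hDne p hp)
  have hE : sketchE K K' (fun h s => ∑ i : Fin K', ((sketchP K K' h s).mulVec x) i ^ 2) = S := by
    rw [skE_congr K K' _ _ (fun h s hs => sk_expand K K' x h s hs), skE_add, hT,
      skE_const K K' hK', add_zero]
  have hE2 : sketchE K K' (fun h s =>
      (∑ i : Fin K', ((sketchP K K' h s).mulVec x) i ^ 2) ^ 2) =
      S ^ 2 + sketchE K K' (fun h s => ∑ p ∈ D, ∑ q ∈ D, skT K K' x p h s * skT K K' x q h s) := by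
    rw [skE_congr K K' _ (fun h s => (S ^ 2 + 2 * S * ∑ p ∈ D, skT K K' x p h s) +
      ∑ p ∈ D, ∑ q ∈ D, skT K K' x p h s * skT K K' x q h s)]
    · rw [skE_add, skE_add, skE_const K K' hK', skE_mul, hT]
      ring
    · intro h s hs
      rw [sk_expand K K' x h s hs, ← Finset.sum_mul_sum]
      ring
  unfold sketchVar
  rw [hE, hE2, add_sub_cancel_left, skE_sum, Finset.mul_sum]
  refine Finset.sum_congr rfl fun p hp => ?_
  have hne := hDne p hp
  rw [skE_sum]
  have hps : p ≠ p.swap := fun h => hne (congrArg Prod.fst h)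
  have hswap : p.swap ∈ D := by simpa [hD] using hne.symm
  rw [← Finset.sum_subset (s₁ := {p, p.swap})]
  · rw [Finset.sum_pair hps]
    simp only [skT_swap]
    rw [skE_TT_self K K' hK' x p hne]
    ring
  · intro q hq
    simp only [Finset.mem_insert, Finset.mem_singleton] at hq
    rcases hq with rfl | rfl <;> assumption
  · intro q hq hq2
    simp only [Finset.mem_insert, Finset.mem_singleton, not_or] at hq2
    exact skE_TT_ne K K' x p q hne (hDne q hq) hq2.1 hq2.2

/-- exact variance of the sketched squared norm, and the bound
`Var(‖Px‖²) ≤ (2/K') ‖x‖⁴`. -/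
theorem countSketch_normSq_variance (K K' : ℕ) (hK : 0 < K) (hK' : 0 < K')
    (x : Fin K → ℝ) :
    sketchVar K K' (fun h s =>
        ∑ i : Fin K', ((sketchP K K' h s).mulVec x) i ^ 2) =
      (2 / (K' : ℝ)) *
        ∑ j : Fin K, ∑ k ∈ Finset.univ.filter (fun k : Fin K => k ≠ j),
          x j ^ 2 * x k ^ 2 ∧
    sketchVar K K' (fun h s =>
        ∑ i : Fin K', ((sketchP K K' h s).mulVec x) i ^ 2) ≤
      (2 / (K' : ℝ)) * (∑ j : Fin K, x j ^ 2) ^ 2 := by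
  have hsum : ∑ j : Fin K, ∑ k ∈ Finset.univ.filter (fun k : Fin K => k ≠ j),
      x j ^ 2 * x k ^ 2 =
      ∑ p ∈ (Finset.univ : Finset (Fin K)).offDiag, x p.1 ^ 2 * x p.2 ^ 2 := by
    rw [Finset.sum_sigma']
    refine Finset.sum_bij' (fun a _ => (a.1, a.2)) (fun p _ => ⟨p.1, p.2⟩) ?_ ?_ ?_ ?_ ?_
    · intro a ha
      simpa [eq_comm] using ha
    · intro p hp
      simpa [eq_comm] using hp
    · intros; rfl
    · intros; rfl
    · intros; rfl
  have hv := sk_var K K' hK' x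
  refine ⟨by rw [hv, hsum], ?_⟩
  rw [hv]
  refine mul_le_mul_of_nonneg_left ?_ (by positivity)
  rw [pow_two, Finset.sum_mul_sum, ← Finset.sum_product']
  refine Finset.sum_le_sum_of_subset_of_nonneg ?_ (fun p _ _ => by positivity)
  intro p _
  simp
end
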